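/- Let p ≥ 1, let A be a p×p complex positive definite (self-adjoint) matrix, and let α_1, α_2, α_3 be complex numbers with Re(α_j) > p-1 for j = 1, 2, 3. Let f₂ be the complex matrix-variate type-2 Dirichlet density with k = 2: f₂(X_1, X_2) = D̃_2 det(X_1)^{α_1 - p} det(X_2)^{α_2 - p} det(I + X_1 + X_2)^{-(α_1 + α_2 + α_3)}, with D̃_2 = Γ̃_p(α_1 + α_2 + α_3) / (Γ̃_p(α_1) Γ̃_p(α_2) Γ̃_p(α_3)), supported on pairs of positive definite p×p self-adjoint matrices. Then the Dirichlet average of φ₆(X_1, X_2) = e^{-tr(A X_1)} · det(I + X_1)^{α_1 + α_3} with respect to f₂ equals ( Γ̃_p(α_1 + α_3) / Γ̃_p(α_3) ) · det(A)^{-α_1}. -/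

import Mathlib

open MeasureTheory Matrix
open scoped ComplexOrder

noncomputable section

/-- Parameter space `ℝ^p × ℂ^{p(p-1)/2}` for `p × p` Hermitian matrices:
the real diagonal entries together with the strictly upper-triangular complex entries. -/
abbrev HermParam (p : ℕ) : Type :=
  (Fin p → ℝ) × ({ q : Fin p × Fin p // q.1 < q.2 } → ℂ)

/-- The linear isomorphism sending the parameters to the corresponding self-adjoint matrix. -/
def toHermMatrix (p : ℕ) (T : HermParam p) : Matrix (Fin p) (Fin p) ℂ :=
  Matrix.of fun i j =>
    if h : i < j then T.2 ⟨(i, j), h⟩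
    else if h' : j < i then (starRingEnd ℂ) (T.2 ⟨(j, i), h'⟩)
    else (T.1 i : ℂ)

noncomputable instance matrixComplexMeasureSpace (m n : ℕ) :
    MeasureSpace (Matrix (Fin m) (Fin n) ℂ) :=
  inferInstanceAs (MeasureSpace (Fin m → Fin n → ℂ))

/-- The Lebesgue measure `μ_p` on Herm(p), realized as a measure on the space of
`p × p` complex matrices: the pushforward of Lebesgue measure on the parameter space
under the linear isomorphism `toHermMatrix p`. -/
def hermLebesgue (p : ℕ) : Measure (Matrix (Fin p) (Fin p) ℂ) :=
  Measure.map (toHermMatrix p) volume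

/-- The complex matrix-variate gamma function
`Γ̃_p(α) = π^{p(p-1)/2} ∏_{j=1}^p Γ(α - j + 1) = π^{p(p-1)/2} ∏_{j=0}^{p-1} Γ(α - j)`. -/
def cGammaP (p : ℕ) (α : ℂ) : ℂ :=
  (Real.pi : ℂ) ^ (p * (p - 1) / 2) * ∏ j : Fin p, Complex.Gamma (α - j)

end

instance matrixComplexBorelSpace (m n : ℕ) : BorelSpace (Matrix (Fin m) (Fin n) ℂ) :=
  inferInstanceAs (BorelSpace (Fin m → Fin n → ℂ))

instance matrixComplexSecondCountable (m n : ℕ) :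
    SecondCountableTopology (Matrix (Fin m) (Fin n) ℂ) :=
  inferInstanceAs (SecondCountableTopology (Fin m → Fin n → ℂ))

lemma measurable_toHermMatrix (p : ℕ) : Measurable (toHermMatrix p) := by
  refine measurable_pi_lambda _ fun i => measurable_pi_lambda _ fun j => ?_
  simp only [toHermMatrix, Matrix.of_apply]
  split_ifs <;> fun_prop

instance hermLebesgue_sFinite (p : ℕ) : SFinite (hermLebesgue p) := by
  unfold hermLebesgue; infer_instance

lemma posDef_iff_posSemidef_and_det_ne_zero {p : ℕ} (X : Matrix (Fin p) (Fin p) ℂ) :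
    X.PosDef ↔ X.PosSemidef ∧ X.det ≠ 0 :=
  ⟨fun h => ⟨h.posSemidef, h.det_pos.ne'⟩, fun h => h.1.posDef_iff_det_ne_zero.2 h.2⟩

lemma measurableSet_posDef (p : ℕ) :
    MeasurableSet {X : Matrix (Fin p) (Fin p) ℂ | X.PosDef} := by
  simp only [posDef_iff_posSemidef_and_det_ne_zero, Matrix.posSemidef_iff_dotProduct_mulVec]
  refine .inter (.inter ?_ ?_) ?_
  · exact (isClosed_eq (continuous_id.matrix_conjTranspose) continuous_id).measurableSet
  · have : IsClosed {X : Matrix (Fin p) (Fin p) ℂ | ∀ x : Fin p → ℂ, 0 ≤ star x ⬝ᵥ X *ᵥ x} := by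
      rw [Set.ofPred_forall]
      refine isClosed_iInter fun x => isClosed_le continuous_const ?_
      exact continuous_const.dotProduct (continuous_id.matrix_mulVec continuous_const)
    exact this.measurableSet
  · exact (isOpen_ne_fun (continuous_id.matrix_det) continuous_const).measurableSet

/-- The one-point-plus-`n` decomposition of the indices. -/
def unitSumFinEquiv (n : ℕ) : Unit ⊕ Fin n ≃ Fin (n + 1) where
  toFun := Sum.elim (fun _ => 0) Fin.succ
  invFun := Fin.cases (.inl ()) .inr
  left_inv := by rintro (_ | _) <;> simp
  right_inv := by intro i; induction i using Fin.cases <;> simp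

/-- The Hermitian bordering of a matrix `Z` by a real corner `x` and a first row `y`. -/
def borderedMatrix {n : ℕ} (x : ℝ) (y : Fin n → ℂ) (Z : Matrix (Fin n) (Fin n) ℂ) :
    Matrix (Fin (n + 1)) (Fin (n + 1)) ℂ :=
  Matrix.of (Fin.cons (Fin.cons (x : ℂ) y) fun i => Fin.cons (star (y i)) (Z i))

section bordered

variable {n : ℕ} (x : ℝ) (y : Fin n → ℂ) (Z : Matrix (Fin n) (Fin n) ℂ)

@[simp] lemma borderedMatrix_zero_zero : borderedMatrix x y Z 0 0 = x := rfl

@[simp] lemma borderedMatrix_zero_succ (j : Fin n) : borderedMatrix x y Z 0 j.succ = y j := rfl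

@[simp] lemma borderedMatrix_succ_zero (i : Fin n) :
    borderedMatrix x y Z i.succ 0 = star (y i) := rfl

@[simp] lemma borderedMatrix_succ_succ (i j : Fin n) :
    borderedMatrix x y Z i.succ j.succ = Z i j := rfl

lemma borderedMatrix_submatrix :
    (borderedMatrix x y Z).submatrix (unitSumFinEquiv n) (unitSumFinEquiv n) =
      fromBlocks (Matrix.of fun _ _ => (x : ℂ)) (Matrix.of fun _ => y)
        (Matrix.of fun _ : Unit => y)ᴴ Z := by
  ext (i | i) (j | j) <;> rfl

lemma det_borderedMatrix_eq_fromBlocks :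
    (borderedMatrix x y Z).det =
      (fromBlocks (Matrix.of fun _ _ => (x : ℂ)) (Matrix.of fun _ => y)
        (Matrix.of fun _ : Unit => y)ᴴ Z).det := by
  rw [← borderedMatrix_submatrix, det_submatrix_equiv_self]

lemma posDef_of_scalar {x : ℝ} (hx : 0 < x) :
    (Matrix.of fun _ _ : Unit => (x : ℂ)).PosDef := by
  have : (Matrix.of fun _ _ : Unit => (x : ℂ)) = Matrix.diagonal fun _ => (x : ℂ) := by
    ext i j; simp
  rw [this, posDef_diagonal_iff]
  simpa using hx

/-- The rank-one matrix whose subtraction gives the Schur complement of the corner. -/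
noncomputable def schurShift (x : ℝ) (y : Fin n → ℂ) : Matrix (Fin n) (Fin n) ℂ :=
  (x : ℂ)⁻¹ • vecMulVec (star y) y

variable {x}

lemma schurShift_eq_mul (hx : 0 < x) :
    schurShift x y = (Matrix.of fun _ : Unit => y)ᴴ * (Matrix.of fun _ _ : Unit => (x : ℂ))⁻¹ *
      (Matrix.of fun _ : Unit => y) := by
  have : (Matrix.of fun _ _ : Unit => (x : ℂ))⁻¹ = Matrix.of fun _ _ => (x : ℂ)⁻¹ := by
    refine Matrix.inv_eq_right_inv ?_
    ext i j
    simp [Matrix.mul_apply, hx.ne']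
  rw [this]
  ext i j
  simp [schurShift, Matrix.mul_apply, vecMulVec_apply]
  ring

lemma det_borderedMatrix_add_schurShift (hx : 0 < x) :
    (borderedMatrix x y (Z + schurShift x y)).det = x * Z.det := by
  have hu := (posDef_of_scalar hx).isUnit
  let := hu.invertible
  rw [det_borderedMatrix_eq_fromBlocks, det_fromBlocks₁₁, invOf_eq_nonsing_inv,
    ← schurShift_eq_mul _ hx, add_sub_cancel_right]
  simp

lemma posDef_borderedMatrix_add_schurShift (hx : 0 < x) :
    (borderedMatrix x y (Z + schurShift x y)).PosDef ↔ Z.PosDef := by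
  have hp := posDef_of_scalar hx
  let := hp.isUnit.invertible
  rw [posDef_iff_posSemidef_and_det_ne_zero, posDef_iff_posSemidef_and_det_ne_zero,
    det_borderedMatrix_add_schurShift _ _ hx,
    ← posSemidef_submatrix_equiv (unitSumFinEquiv n), borderedMatrix_submatrix,
    hp.fromBlocks₁₁, ← schurShift_eq_mul _ hx, add_sub_cancel_right]
  simp [hx.ne']

lemma pos_of_posDef_borderedMatrix (h : (borderedMatrix x y Z).PosDef) : 0 < x := by
  simpa using h.diag_pos (i := 0)

/-- The Schur complement of the lower right block is positive, and multiplies its determinant. -/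
lemma posDef_borderedMatrix_schur (h : (borderedMatrix x y Z).PosDef) :
    Z.PosDef ∧ ∃ s : ℝ, 0 < s ∧ y ⬝ᵥ Z⁻¹ *ᵥ star y = (x - s : ℝ) ∧
      (borderedMatrix x y Z).det.re = s * Z.det.re := by
  have hZ : Z.PosDef := by
    convert! h.submatrix (Fin.succ_injective n)
  let := hZ.isUnit.invertible
  have hd : (borderedMatrix x y Z).det = Z.det * (x - y ⬝ᵥ Z⁻¹ *ᵥ star y) := by
    rw [det_borderedMatrix_eq_fromBlocks, det_fromBlocks₂₂, invOf_eq_nonsing_inv]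
    congr 1
    rw [det_unique]
    simp only [Matrix.sub_apply, Matrix.of_apply, Matrix.mul_assoc]
    rfl
  have h1 := h.det_pos
  have h2 := hZ.det_pos
  rw [hd] at h1
  have h3 : (0 : ℂ) < x - y ⬝ᵥ Z⁻¹ *ᵥ star y := (mul_pos_iff_of_pos_left h2).1 h1
  rw [Complex.lt_def] at h3 h2
  refine ⟨hZ, (x - y ⬝ᵥ Z⁻¹ *ᵥ star y).re, h3.1, ?_, ?_⟩
  · apply Complex.ext
    · simp
    · have := h3.2; simp at this; simp [this]
  · rw [hd, Complex.mul_re, ← h3.2]; simp; ring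

end bordered

lemma measurePreserving_prodProdProdComm {α β γ δ : Type*} [MeasureSpace α] [MeasureSpace β]
    [MeasureSpace γ] [MeasureSpace δ] [SigmaFinite (volume : Measure α)]
    [SigmaFinite (volume : Measure β)] [SigmaFinite (volume : Measure γ)]
    [SigmaFinite (volume : Measure δ)] :
    MeasurePreserving fun q : (α × β) × (γ × δ) => ((q.1.1, q.2.1), (q.1.2, q.2.2)) := by
  have h1 : MeasurePreserving (MeasurableEquiv.prodAssoc : (α × β) × (γ × δ) ≃ᵐ _) :=
    measurePreserving_prodAssoc _ _ _
  have h2 : MeasurePreserving (MeasurableEquiv.prodAssoc : (β × γ) × δ ≃ᵐ _).symm :=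
    (measurePreserving_prodAssoc _ _ _).symm
  have h3 : MeasurePreserving (Prod.map Prod.swap id : (β × γ) × δ → (γ × β) × δ) :=
    Measure.measurePreserving_swap.prod (MeasurePreserving.id _)
  have h4 : MeasurePreserving (MeasurableEquiv.prodAssoc : (γ × β) × δ ≃ᵐ _) :=
    measurePreserving_prodAssoc _ _ _
  have h5 : MeasurePreserving (MeasurableEquiv.prodAssoc : (α × γ) × (β × δ) ≃ᵐ _).symm :=
    (measurePreserving_prodAssoc _ _ _).symm
  exact h5.comp (((MeasurePreserving.id _).prod (h4.comp (h3.comp h2))).comp h1)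

/-- Strictly upper-triangular index pairs of size `n + 1`: those of the first row, and the rest. -/
noncomputable def upperIndexEquiv (n : ℕ) :
    Fin n ⊕ { q : Fin n × Fin n // q.1 < q.2 } ≃
      { q : Fin (n + 1) × Fin (n + 1) // q.1 < q.2 } :=
  Equiv.ofBijective
    (Sum.elim (fun j => ⟨(0, j.succ), j.succ_pos⟩)
      fun q => ⟨(q.1.1.succ, q.1.2.succ), Fin.succ_lt_succ_iff.2 q.2⟩) <| by
    constructor
    · rintro (i | ⟨⟨i, i'⟩, hi⟩) (j | ⟨⟨j, j'⟩, hj⟩) h <;> simp_all [Fin.ext_iff]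
    · rintro ⟨⟨i, j⟩, h⟩
      induction j using Fin.cases with
      | zero => exact absurd h (Fin.not_lt_zero i)
      | succ j =>
        induction i using Fin.cases with
        | zero => exact ⟨.inl j, rfl⟩
        | succ i => exact ⟨.inr ⟨(i, j), Fin.succ_lt_succ_iff.1 h⟩, rfl⟩

/-- Hermitian parameters of size `n + 1` from a corner, a first row and parameters of size `n`. -/
noncomputable def borderedParam (n : ℕ) (q : (ℝ × (Fin n → ℂ)) × HermParam n) : HermParam (n + 1) :=
  ((MeasurableEquiv.piFinSuccAbove (fun _ => ℝ) 0).symm (q.1.1, q.2.1),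
    MeasurableEquiv.piCongrLeft (fun _ => ℂ) (upperIndexEquiv n)
      ((MeasurableEquiv.sumPiEquivProdPi fun _ => ℂ).symm (q.1.2, q.2.2)))

lemma measurePreserving_borderedParam (n : ℕ) : MeasurePreserving (borderedParam n) := by
  have h1 : MeasurePreserving (MeasurableEquiv.piFinSuccAbove (fun _ : Fin (n + 1) => ℝ) 0).symm :=
    (volume_preserving_piFinSuccAbove (fun _ : Fin (n + 1) => ℝ) 0).symm
  have h2 := volume_measurePreserving_piCongrLeft (fun _ => ℂ) (upperIndexEquiv n)
  have h3 := volume_measurePreserving_sumPiEquivProdPi_symm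
    (fun _ : Fin n ⊕ { q : Fin n × Fin n // q.1 < q.2 } => ℂ)
  exact (h1.prod (h2.comp h3)).comp measurePreserving_prodProdProdComm

lemma toHermMatrix_borderedParam (n : ℕ) (q : (ℝ × (Fin n → ℂ)) × HermParam n) :
    toHermMatrix (n + 1) (borderedParam n q) =
      borderedMatrix q.1.1 q.1.2 (toHermMatrix n q.2) := by
  have hl (j : Fin n) (h) : (borderedParam n q).2 ⟨(0, j.succ), h⟩ = q.1.2 j :=
    Equiv.piCongrLeft_sumInl (fun _ => ℂ) (upperIndexEquiv n) q.1.2 q.2.2 j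
  have hr (i j : Fin n) (h : i < j) (h') :
      (borderedParam n q).2 ⟨(i.succ, j.succ), h'⟩ = q.2.2 ⟨(i, j), h⟩ :=
    Equiv.piCongrLeft_sumInr (fun _ => ℂ) (upperIndexEquiv n) q.1.2 q.2.2 ⟨(i, j), h⟩
  have h0 : (borderedParam n q).1 0 = q.1.1 := rfl
  have hs (i : Fin n) : (borderedParam n q).1 i.succ = q.2.1 i := rfl
  ext i j
  induction i using Fin.cases with
  | zero =>
    induction j using Fin.cases with
    | zero => simp [toHermMatrix, h0]
    | succ j => simp [toHermMatrix, hl]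
  | succ i =>
    induction j using Fin.cases with
    | zero => simp [toHermMatrix, hl]
    | succ j =>
      simp only [toHermMatrix, Matrix.of_apply, Fin.succ_lt_succ_iff, borderedMatrix_succ_succ, hs]
      split_ifs with h h'
      · rw [hr]
      · rw [hr]
      · rfl

lemma measurable_borderedMatrix (n : ℕ) :
    Measurable fun q : (ℝ × (Fin n → ℂ)) × Matrix (Fin n) (Fin n) ℂ =>
      borderedMatrix q.1.1 q.1.2 q.2 := by
  refine measurable_pi_lambda _ fun i => measurable_pi_lambda _ fun j => ?_
  have (i j : Fin n) : Measurable fun Z : Matrix (Fin n) (Fin n) ℂ => Z i j :=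
    (measurable_pi_apply j).comp (measurable_pi_apply i)
  induction i using Fin.cases with
  | zero =>
    induction j using Fin.cases with
    | zero => simp only [borderedMatrix_zero_zero]; fun_prop
    | succ j => simp only [borderedMatrix_zero_succ]; fun_prop
  | succ i =>
    induction j using Fin.cases with
    | zero => simp only [borderedMatrix_succ_zero]; fun_prop
    | succ j => simp only [borderedMatrix_succ_succ]; exact (this i j).comp measurable_snd

lemma measurePreserving_borderedMatrix (n : ℕ) :
    MeasurePreserving (fun q : (ℝ × (Fin n → ℂ)) × Matrix (Fin n) (Fin n) ℂ =>
      borderedMatrix q.1.1 q.1.2 q.2) (volume.prod (hermLebesgue n)) (hermLebesgue (n + 1)) := by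
  refine ⟨measurable_borderedMatrix n, ?_⟩
  have h : (volume : Measure (ℝ × (Fin n → ℂ))).prod (hermLebesgue n) =
      Measure.map (Prod.map id (toHermMatrix n)) volume := by
    rw [Measure.volume_eq_prod (ℝ × (Fin n → ℂ)) (HermParam n), ← Measure.map_prod_map _ _
      measurable_id (measurable_toHermMatrix n), Measure.map_id]
    rfl
  rw [h, Measure.map_map (measurable_borderedMatrix n)
    (measurable_id.prodMap (measurable_toHermMatrix n)), hermLebesgue,
    ← (measurePreserving_borderedParam n).map_eq,
    Measure.map_map (measurable_toHermMatrix _) (measurePreserving_borderedParam n).measurable]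
  congr 1
  ext1 q
  exact (toHermMatrix_borderedParam n q).symm

lemma toHermMatrix_add (p : ℕ) (S T : HermParam p) :
    toHermMatrix p (S + T) = toHermMatrix p S + toHermMatrix p T := by
  ext i j
  simp only [toHermMatrix, Matrix.of_apply, Matrix.add_apply]
  split_ifs <;> simp

lemma Matrix.IsHermitian.exists_toHermMatrix {p : ℕ} {S : Matrix (Fin p) (Fin p) ℂ}
    (hS : S.IsHermitian) : ∃ T, toHermMatrix p T = S := by
  refine ⟨(fun i => (S i i).re, fun q => S q.1.1 q.1.2), ?_⟩
  ext i j
  simp only [toHermMatrix, Matrix.of_apply]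
  split_ifs with h h'
  · rfl
  · exact hS.apply i j
  · obtain rfl : i = j := le_antisymm (not_lt.1 h') (not_lt.1 h)
    exact hS.coe_re_apply_self i

lemma map_add_right_hermLebesgue {p : ℕ} {S : Matrix (Fin p) (Fin p) ℂ} (hS : S.IsHermitian) :
    Measure.map (· + S) (hermLebesgue p) = hermLebesgue p := by
  obtain ⟨T, rfl⟩ := hS.exists_toHermMatrix
  have hcomp : (· + toHermMatrix p T) ∘ toHermMatrix p = toHermMatrix p ∘ (T + ·) := by
    ext1 U
    simp [toHermMatrix_add, add_comm]
  have : (volume : Measure (HermParam p)).IsAddLeftInvariant :=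
    Measure.prod.instIsAddLeftInvariant (μ := (volume : Measure (Fin p → ℝ)))
      (ν := (volume : Measure ({ q : Fin p × Fin p // q.1 < q.2 } → ℂ)))
  rw [hermLebesgue, Measure.map_map (by fun_prop) (measurable_toHermMatrix p), hcomp,
    ← Measure.map_map (measurable_toHermMatrix p) (by fun_prop), map_add_left_eq_self]

lemma isHermitian_schurShift {n : ℕ} (x : ℝ) (y : Fin n → ℂ) : (schurShift x y).IsHermitian := by
  ext i j
  simp [schurShift, vecMulVec_apply, mul_comm]

lemma measurable_schurShift (n : ℕ) :
    Measurable fun q : ℝ × (Fin n → ℂ) => schurShift q.1 q.2 := by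
  refine measurable_pi_lambda _ fun i => measurable_pi_lambda _ fun j => ?_
  simp only [schurShift, Matrix.smul_apply, vecMulVec_apply, Pi.star_apply]
  fun_prop

/-- Lebesgue measure in the coordinates corner, first row and Schur complement. -/
lemma measurePreserving_borderedMatrix_add_schurShift (n : ℕ) :
    MeasurePreserving (fun q : (ℝ × (Fin n → ℂ)) × Matrix (Fin n) (Fin n) ℂ =>
      borderedMatrix q.1.1 q.1.2 (q.2 + schurShift q.1.1 q.1.2))
      (volume.prod (hermLebesgue n)) (hermLebesgue (n + 1)) := by
  have h : MeasurePreserving (fun q : (ℝ × (Fin n → ℂ)) × Matrix (Fin n) (Fin n) ℂ =>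
      (q.1, q.2 + schurShift q.1.1 q.1.2)) (volume.prod (hermLebesgue n))
      (volume.prod (hermLebesgue n)) := by
    refine (MeasurePreserving.id volume).skew_product
      (g := fun (q : ℝ × (Fin n → ℂ)) Z => Z + schurShift q.1 q.2) ?_ ?_
    · exact measurable_snd.add ((measurable_schurShift n).comp measurable_fst)
    · exact .of_forall fun q => map_add_right_hermLebesgue (isHermitian_schurShift q.1 q.2)
  exact (measurePreserving_borderedMatrix n).comp h

lemma integrable_gaussian_complex {x : ℝ} (hx : 0 < x) (d : ℂ) :
    Integrable (fun w : ℂ => Real.exp (-(Complex.normSq w / x + 2 * (d * w).re))) ∧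
      ∫ w : ℂ, Real.exp (-(Complex.normSq w / x + 2 * (d * w).re)) =
        Real.pi * x * Real.exp (x * Complex.normSq d) := by
  have hb : 0 < ((x⁻¹ : ℝ) : ℂ).re := by simpa using hx
  have h (w : ℂ) : ((Real.exp (-(Complex.normSq w / x + 2 * (d * w).re)) : ℝ) : ℂ) =
      Complex.exp (-(x⁻¹ : ℝ) * (‖w‖ : ℂ) ^ 2 +
        (-2) * ((inner ℝ (starRingEnd ℂ d) w : ℝ) : ℂ)) := by
    rw [Complex.inner, Complex.conj_conj, ← Complex.ofReal_pow, ← Complex.normSq_eq_norm_sq]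
    push_cast
    congr 1
    ring_nf
  constructor
  · have := (GaussianFourier.integrable_cexp_neg_mul_sq_norm_add hb (-2) (starRingEnd ℂ d)).re
    refine this.congr (.of_forall fun w => ?_)
    beta_reduce
    rw [← h]
    rfl
  · have := GaussianFourier.integral_cexp_neg_mul_sq_norm_add hb (-2) (starRingEnd ℂ d)
    simp only [← h] at this
    rw [integral_complex_ofReal] at this
    apply Complex.ofReal_injective
    rw [this, Complex.finrank_real_complex]
    rw [show ((2 : ℕ) : ℂ) / 2 = 1 by norm_num, Complex.cpow_one]
    have hx' : (x : ℂ) ≠ 0 := by exact_mod_cast hx.ne'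
    push_cast
    rw [Complex.normSq_eq_norm_sq, RCLike.norm_conj]
    push_cast
    congr 1
    · field_simp
    · congr 1; field_simp; ring

lemma integrable_gaussian_pi {n : ℕ} {x : ℝ} (hx : 0 < x) (d : Fin n → ℂ) :
    Integrable (fun w : Fin n → ℂ =>
        Real.exp (-((star w ⬝ᵥ w).re / x + 2 * (d ⬝ᵥ w).re))) ∧
      ∫ w : Fin n → ℂ, Real.exp (-((star w ⬝ᵥ w).re / x + 2 * (d ⬝ᵥ w).re)) =
        (Real.pi * x) ^ n * Real.exp (x * (d ⬝ᵥ star d).re) := by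
  have h (w : Fin n → ℂ) : Real.exp (-((star w ⬝ᵥ w).re / x + 2 * (d ⬝ᵥ w).re)) =
      ∏ i, Real.exp (-(Complex.normSq (w i) / x + 2 * (d i * w i).re)) := by
    rw [← Real.exp_sum, Finset.sum_neg_distrib, Finset.sum_add_distrib, ← Finset.sum_div,
      ← Finset.mul_sum, dotProduct, dotProduct, Complex.re_sum, Complex.re_sum]
    simp [Complex.normSq_apply]
  simp only [h]
  constructor
  · exact Integrable.fintype_prod fun i => (integrable_gaussian_complex hx (d i)).1
  · rw [integral_fintype_prod_volume_eq_prod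
      (fun i w => Real.exp (-(Complex.normSq w / x + 2 * (d i * w).re)))]
    simp only [(integrable_gaussian_complex hx _).2]
    rw [Finset.prod_mul_distrib, ← Real.exp_sum, ← Finset.mul_sum, dotProduct, Complex.re_sum]
    simp [Complex.normSq_apply]

lemma map_mulVec_volume {n : ℕ} {M : Matrix (Fin n) (Fin n) ℂ} (hM : M.det ≠ 0) :
    Measure.map (M *ᵥ ·) (volume : Measure (Fin n → ℂ)) =
      ENNReal.ofReal (Complex.normSq M.det)⁻¹ • volume := by
  have hdet : LinearMap.det ((Matrix.toLin' M).restrictScalars ℝ) = Complex.normSq M.det := by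
    rw [LinearMap.det_restrictScalars, LinearMap.det_toLin', Algebra.norm_complex_apply]
  have := Measure.map_linearMap_addHaar_eq_smul_addHaar (volume : Measure (Fin n → ℂ))
    (f := (Matrix.toLin' M).restrictScalars ℝ) (by rw [hdet]; simpa using hM)
  rw [hdet, abs_of_nonneg (inv_nonneg.2 (Complex.normSq_nonneg _))] at this
  exact this

lemma Matrix.PosDef.exists_conjTranspose_mul_self {n : ℕ} {D : Matrix (Fin n) (Fin n) ℂ}
    (hD : D.PosDef) : ∃ M : Matrix (Fin n) (Fin n) ℂ, D = Mᴴ * M := by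
  open scoped MatrixOrder in
  exact CStarAlgebra.nonneg_iff_eq_star_mul_self.mp hD.posSemidef.nonneg

lemma integrable_gaussian_posDef {n : ℕ} {D : Matrix (Fin n) (Fin n) ℂ} (hD : D.PosDef)
    (b : Fin n → ℂ) {x : ℝ} (hx : 0 < x) :
    Integrable (fun y : Fin n → ℂ =>
        Real.exp (-((y ⬝ᵥ D *ᵥ star y).re / x + 2 * (b ⬝ᵥ star y).re))) ∧
      ∫ y : Fin n → ℂ, Real.exp (-((y ⬝ᵥ D *ᵥ star y).re / x + 2 * (b ⬝ᵥ star y).re)) =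
        (Real.pi * x) ^ n / D.det.re * Real.exp (x * (b ⬝ᵥ D⁻¹ *ᵥ star b).re) := by
  obtain ⟨M, hM⟩ := hD.transpose.exists_conjTranspose_mul_self
  have hdet : D.det = Complex.normSq M.det := by
    rw [← det_transpose, hM, det_mul, det_conjTranspose, Complex.normSq_eq_conj_mul_self]
    rfl
  have hM0 : M.det ≠ 0 := by
    intro h
    have := hD.det_pos
    simp [hdet, h] at this
  have hu : IsUnit M.det := isUnit_iff_ne_zero.2 hM0
  set d := star b ᵥ* M⁻¹ with hd
  have hquad (y : Fin n → ℂ) : y ⬝ᵥ D *ᵥ star y = star (M *ᵥ y) ⬝ᵥ (M *ᵥ y) := by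
    rw [star_mulVec, ← dotProduct_mulVec, mulVec_mulVec, ← hM, mulVec_transpose,
      dotProduct_mulVec, dotProduct_comm]
  have hlin (y : Fin n → ℂ) : (b ⬝ᵥ star y).re = (d ⬝ᵥ (M *ᵥ y)).re := by
    rw [hd, dotProduct_mulVec, vecMul_vecMul, nonsing_inv_mul _ hu, vecMul_one]
    simp [dotProduct, Complex.re_sum]
  have hconst : b ⬝ᵥ D⁻¹ *ᵥ star b = d ⬝ᵥ star d := by
    have : D⁻¹ = (M⁻¹ * M⁻¹ᴴ)ᵀ := by
      rw [conjTranspose_nonsing_inv, ← Matrix.mul_inv_rev, ← hM, ← transpose_nonsing_inv,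
        transpose_transpose]
    rw [hd, star_vecMul, star_star, dotProduct_mulVec, this, vecMul_transpose, dotProduct_comm,
      ← mulVec_mulVec, dotProduct_mulVec]
  have hmeas : Measurable (M *ᵥ · : (Fin n → ℂ) → Fin n → ℂ) :=
    (continuous_const.matrix_mulVec continuous_id).measurable
  obtain ⟨h1, h2⟩ := integrable_gaussian_pi hx d
  have hc := map_mulVec_volume hM0
  simp only [hquad, hlin]
  have h1' := h1.smul_measure (c := ENNReal.ofReal (Complex.normSq M.det)⁻¹) (by simp)
  rw [← hc] at h1'
  constructor
  · exact h1'.comp_measurable hmeas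
  · rw [← integral_map (f := fun w => Real.exp (-((star w ⬝ᵥ w).re / x + 2 * (d ⬝ᵥ w).re)))
      hmeas.aemeasurable h1'.aestronglyMeasurable, hc, integral_smul_measure, h2, hconst,
      ENNReal.toReal_ofReal (inv_nonneg.2 (Complex.normSq_nonneg _)), hdet, Complex.ofReal_re,
      smul_eq_mul]
    ring

/-- The integrand of the matrix gamma integral, extended by zero off the positive definite cone. -/
noncomputable def wishartKernel {p : ℕ} (A : Matrix (Fin p) (Fin p) ℂ) (α : ℂ) :
    Matrix (Fin p) (Fin p) ℂ → ℂ :=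
  {X | X.PosDef}.indicator fun X =>
    (Real.exp (-(A * X).trace.re) : ℂ) * (X.det.re : ℂ) ^ (α - p)

lemma measurable_uncurry_wishartKernel (p : ℕ) (α : ℂ) :
    Measurable fun q : Matrix (Fin p) (Fin p) ℂ × Matrix (Fin p) (Fin p) ℂ =>
      wishartKernel q.1 α q.2 := by
  have h1 : Continuous fun q : Matrix (Fin p) (Fin p) ℂ × Matrix (Fin p) (Fin p) ℂ =>
      (q.1 * q.2).trace := (continuous_fst.matrix_mul continuous_snd).matrix_trace
  have h2 : Continuous fun q : Matrix (Fin p) (Fin p) ℂ × Matrix (Fin p) (Fin p) ℂ => q.2.det :=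
    continuous_snd.matrix_det
  have := h1.measurable
  have := h2.measurable
  have h3 : (fun q : Matrix (Fin p) (Fin p) ℂ × Matrix (Fin p) (Fin p) ℂ =>
      wishartKernel q.1 α q.2) = (Prod.snd ⁻¹' {X | X.PosDef}).indicator fun q =>
        (Real.exp (-(q.1 * q.2).trace.re) : ℂ) * (q.2.det.re : ℂ) ^ (α - p) := by
    ext q
    simp [wishartKernel, Set.indicator]
  rw [h3]
  exact Measurable.indicator (by fun_prop) (measurable_snd (measurableSet_posDef p))

lemma measurable_wishartKernel {p : ℕ} (A : Matrix (Fin p) (Fin p) ℂ) (α : ℂ) :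
    Measurable (wishartKernel A α) := by
  have h := (measurable_uncurry_wishartKernel p α).comp (measurable_prodMk_left (x := A))
  exact h

/-- Fubini for the product of an outer factor and a kernel. -/
lemma integrable_prod_mul {X Y : Type*} [MeasurableSpace X] [MeasurableSpace Y]
    {μ : Measure X} {ν : Measure Y} [SFinite μ] [SFinite ν] {k : X → ℂ} {g : X → Y → ℂ}
    (hm : AEStronglyMeasurable (fun q : X × Y => k q.1 * g q.1 q.2) (μ.prod ν))
    (hg : ∀ x, k x ≠ 0 → Integrable (g x) ν)
    (hk : Integrable (fun x => (‖k x‖ : ℂ) * ((∫ y, ‖g x y‖ ∂ν : ℝ) : ℂ)) μ) :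
    Integrable (fun q : X × Y => k q.1 * g q.1 q.2) (μ.prod ν) ∧
      ∫ q, k q.1 * g q.1 q.2 ∂(μ.prod ν) = ∫ x, k x * ∫ y, g x y ∂ν ∂μ := by
  have hint : Integrable (fun q : X × Y => k q.1 * g q.1 q.2) (μ.prod ν) := by
    refine (integrable_prod_iff hm).2 ⟨.of_forall fun x => ?_, ?_⟩
    · by_cases hx : k x = 0
      · simp [hx]
      · exact (hg x hx).const_mul (k x)
    · simp only [← Complex.ofReal_mul] at hk
      simpa only [norm_mul, integral_const_mul, RCLike.re_eq_complex_re, Complex.ofReal_re]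
        using hk.re
  refine ⟨hint, ?_⟩
  rw [integral_prod _ hint]
  simp only [integral_const_mul]

/-- Fubini for a product density whose inner factor is nonnegative. -/
lemma integrable_prod_mul_ofReal {X Y : Type*} [MeasurableSpace X] [MeasurableSpace Y]
    {μ : Measure X} {ν : Measure Y} [SFinite μ] [SFinite ν] {k : X → ℂ} {g : X → Y → ℝ}
    (hm : AEStronglyMeasurable (fun q : X × Y => k q.1 * (g q.1 q.2 : ℂ)) (μ.prod ν))
    (hg0 : ∀ x y, 0 ≤ g x y) (hg : ∀ x, k x ≠ 0 → Integrable (g x) ν)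
    (hk : Integrable (fun x => k x * ((∫ y, g x y ∂ν : ℝ) : ℂ)) μ) :
    Integrable (fun q : X × Y => k q.1 * (g q.1 q.2 : ℂ)) (μ.prod ν) ∧
      ∫ q, k q.1 * (g q.1 q.2 : ℂ) ∂(μ.prod ν) = ∫ x, k x * ((∫ y, g x y ∂ν : ℝ) : ℂ) ∂μ := by
  have h := integrable_prod_mul hm (fun x hx => (hg x hx).ofReal (𝕜 := ℂ))
    (hk.norm.ofReal.congr (.of_forall fun x => by
      simp [abs_of_nonneg (hg0 _ _), abs_of_nonneg (integral_nonneg (μ := ν) (f := g x) (hg0 x))]))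
  simpa only [Complex.coe_algebraMap, integral_complex_ofReal] using h

lemma trace_borderedMatrix_mul {n : ℕ} (a x : ℝ) (b y : Fin n → ℂ)
    (D Z : Matrix (Fin n) (Fin n) ℂ) :
    (borderedMatrix a b D * borderedMatrix x y Z).trace.re =
      a * x + 2 * (b ⬝ᵥ star y).re + (D * Z).trace.re := by
  have h : (star b ⬝ᵥ y).re = (b ⬝ᵥ star y).re := by
    simp [dotProduct, Complex.re_sum]
  have : (borderedMatrix a b D * borderedMatrix x y Z).trace =
      a * x + b ⬝ᵥ star y + (star b ⬝ᵥ y + (D * Z).trace) := by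
    simp [Matrix.trace, Matrix.mul_apply, Fin.sum_univ_succ, dotProduct, Finset.sum_add_distrib]
    ring
  rw [this]
  simp [h]
  ring

lemma trace_mul_schurShift {n : ℕ} (x : ℝ) (y : Fin n → ℂ) (D : Matrix (Fin n) (Fin n) ℂ) :
    (D * schurShift x y).trace.re = (y ⬝ᵥ D *ᵥ star y).re / x := by
  have : (D * schurShift x y).trace = (x⁻¹ : ℝ) * (y ⬝ᵥ D *ᵥ star y) := by
    rw [schurShift, Matrix.mul_smul, trace_smul, mul_vecMulVec, trace_vecMulVec, dotProduct_comm]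
    simp
  rw [this, Complex.re_ofReal_mul]
  ring

lemma Matrix.IsHermitian.eq_borderedMatrix {n : ℕ} {A : Matrix (Fin (n + 1)) (Fin (n + 1)) ℂ}
    (hA : A.IsHermitian) :
    A = borderedMatrix (A 0 0).re (fun j => A 0 j.succ) (A.submatrix Fin.succ Fin.succ) := by
  ext i j
  induction i using Fin.cases with
  | zero =>
    induction j using Fin.cases with
    | zero => exact (hA.coe_re_apply_self 0).symm
    | succ j => rfl
  | succ i =>
    induction j using Fin.cases with
    | zero => exact (hA.apply i.succ 0).symm
    | succ j => rfl

lemma cGammaP_succ (n : ℕ) (α : ℂ) :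
    cGammaP (n + 1) α = Real.pi ^ n * Complex.Gamma α * cGammaP n (α - 1) := by
  have h : (n + 1) * (n + 1 - 1) / 2 = n + n * (n - 1) / 2 := by
    rw [← Finset.sum_range_id_mul_two, ← Finset.sum_range_id_mul_two]
    simp [Finset.sum_range_succ, add_comm]
  simp only [cGammaP, h, Fin.prod_univ_succ, pow_add, Fin.val_zero, Fin.val_succ]
  have (j : Fin n) : α - ((j + 1 : ℕ) : ℂ) = α - 1 - j := by push_cast; ring
  simp only [this, Nat.cast_zero, sub_zero]
  ring

lemma hermLebesgue_zero_univ : hermLebesgue 0 Set.univ = 1 := by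
  rw [hermLebesgue, Measure.map_apply (measurable_toHermMatrix 0) .univ, Set.preimage_univ,
    Measure.volume_eq_prod, ← Set.univ_prod_univ, Measure.prod_prod, Measure.volume_pi_eq_dirac,
    Measure.volume_pi_eq_dirac]
  simp

lemma wishartKernel_borderedMatrix {n : ℕ} (a x : ℝ) (b y : Fin n → ℂ)
    (D Z : Matrix (Fin n) (Fin n) ℂ) (α : ℂ) :
    wishartKernel (borderedMatrix a b D) α (borderedMatrix x y (Z + schurShift x y)) =
      (Set.Ioi 0).indicator (fun x : ℝ => (Real.exp (-(a * x)) : ℂ) * (x : ℂ) ^ (α - (n + 1))) x *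
        (Real.exp (-((y ⬝ᵥ D *ᵥ star y).re / x + 2 * (b ⬝ᵥ star y).re)) : ℝ) *
        wishartKernel D (α - 1) Z := by
  by_cases hx : 0 < x
  swap
  · rw [wishartKernel, Set.indicator_of_notMem,
      Set.indicator_of_notMem (show x ∉ Set.Ioi (0 : ℝ) from hx)]
    · simp
    · exact fun h => hx (pos_of_posDef_borderedMatrix _ _ h)
  rw [Set.indicator_of_mem (show x ∈ Set.Ioi (0 : ℝ) from hx)]
  by_cases hZ : Z.PosDef
  swap
  · have := (posDef_borderedMatrix_add_schurShift y Z hx).not.2 hZ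
    simp [wishartKernel, hZ, this]
  have h := (posDef_borderedMatrix_add_schurShift y Z hx).2 hZ
  have hdet := hZ.det_pos
  rw [Complex.lt_def] at hdet
  rw [wishartKernel, wishartKernel,
    Set.indicator_of_mem (show _ ∈ {X : Matrix _ _ ℂ | X.PosDef} from h),
    Set.indicator_of_mem (show _ ∈ {X : Matrix _ _ ℂ | X.PosDef} from hZ),
    trace_borderedMatrix_mul, Matrix.mul_add, trace_add,
    Complex.add_re, trace_mul_schurShift, det_borderedMatrix_add_schurShift y Z hx,
    Complex.re_ofReal_mul, Complex.ofReal_mul x,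
    Complex.mul_cpow_ofReal_nonneg hx.le (by simpa using hdet.1.le)]
  have : -(a * x + 2 * (b ⬝ᵥ star y).re +
      ((D * Z).trace.re + (y ⬝ᵥ D *ᵥ star y).re / x)) =
      -(a * x) + -((y ⬝ᵥ D *ᵥ star y).re / x + 2 * (b ⬝ᵥ star y).re) + -(D * Z).trace.re := by
    ring
  rw [this, Real.exp_add, Real.exp_add]
  push_cast
  rw [show α - 1 - (n : ℂ) = α - (n + 1) by ring]
  ring

lemma integrable_cpow_mul_exp_neg {α : ℂ} (hα : 0 < α.re) {s : ℝ} (hs : 0 < s) :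
    IntegrableOn (fun x : ℝ => (x : ℂ) ^ (α - 1) * Complex.exp (-(s * x))) (Set.Ioi 0) := by
  have h := integrableOn_rpow_mul_exp_neg_mul_rpow (s := α.re - 1) (p := 1) (b := s)
    (by linarith) one_pos hs
  refine Integrable.mono' h ?_ ?_
  · exact Measurable.aestronglyMeasurable (by fun_prop)
  · filter_upwards [ae_restrict_mem measurableSet_Ioi] with x hx
    rw [norm_mul, Complex.norm_cpow_eq_rpow_re_of_pos hx, Complex.norm_exp]
    simp

lemma integrable_wishartKernel (p : ℕ) {A : Matrix (Fin p) (Fin p) ℂ} (hA : A.PosDef) {α : ℂ}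
    (hα : (p - 1 : ℝ) < α.re) :
    Integrable (wishartKernel A α) (hermLebesgue p) ∧
      ∫ X, wishartKernel A α X ∂(hermLebesgue p) = cGammaP p α * (A.det.re : ℂ) ^ (-α) := by
  induction p generalizing α with
  | zero =>
    have h : wishartKernel A α = fun _ => 1 := by
      ext1 X
      have hX : X.PosDef := by rwa [Subsingleton.elim X A]
      rw [wishartKernel, Set.indicator_of_mem (show X ∈ {X | X.PosDef} from hX)]
      simp [Matrix.trace]
    have : IsFiniteMeasure (hermLebesgue 0) := ⟨by simp [hermLebesgue_zero_univ]⟩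
    simp [h, Measure.real, hermLebesgue_zero_univ, cGammaP]
  | succ n ih =>
    obtain ⟨a, b, D, rfl⟩ : ∃ a b D, A = borderedMatrix a b D :=
      ⟨_, _, _, hA.isHermitian.eq_borderedMatrix⟩
    obtain ⟨hD, s, hs, hsa, hdet⟩ := posDef_borderedMatrix_schur b D hA
    push_cast at hα
    obtain ⟨hi, hv⟩ := ih hD (α := α - 1) (by simp; linarith)
    have hα0 : 0 < α.re := by have : (0 : ℝ) ≤ n := n.cast_nonneg; linarith
    have hd : 0 < D.det.re := (Complex.lt_def.1 hD.det_pos).1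
    set k : ℝ → ℂ := (Set.Ioi 0).indicator
      fun x : ℝ => (Real.exp (-(a * x)) : ℂ) * (x : ℂ) ^ (α - (n + 1)) with hk
    set g : ℝ → (Fin n → ℂ) → ℝ := fun x y =>
      Real.exp (-((y ⬝ᵥ D *ᵥ star y).re / x + 2 * (b ⬝ᵥ star y).re)) with hg
    have hkx {x : ℝ} (hx : k x ≠ 0) : 0 < x := by
      by_contra h
      exact hx (Set.indicator_of_notMem (show x ∉ Set.Ioi (0 : ℝ) from h) _)
    have hkg (x : ℝ) : k x * ((∫ y, g x y : ℝ) : ℂ) = (Set.Ioi 0).indicator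
        (fun x : ℝ => (Real.pi ^ n / D.det.re : ℂ) *
          ((x : ℂ) ^ (α - 1) * Complex.exp (-(s * x)))) x := by
      by_cases hx : 0 < x
      swap
      · simp [hk, hx]
      have hx' : (x : ℂ) ≠ 0 := by exact_mod_cast hx.ne'
      rw [Set.indicator_of_mem (show x ∈ Set.Ioi (0 : ℝ) from hx), hk,
        Set.indicator_of_mem (show x ∈ Set.Ioi (0 : ℝ) from hx),
        (integrable_gaussian_posDef hD b hx).2, hsa,
        Complex.ofReal_re, show α - 1 = (α - (n + 1)) + n by ring, Complex.cpow_add _ _ hx',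
        Complex.cpow_natCast, show -((s : ℂ) * x) = -(a * x) + x * (a - s) by ring, Complex.exp_add]
      push_cast
      rw [mul_pow]
      ring
    have hmeas : Measurable fun q : ℝ × (Fin n → ℂ) => k q.1 * (g q.1 q.2 : ℂ) := by
      have h1 : Measurable k := Measurable.indicator (by fun_prop) measurableSet_Ioi
      have h2 : Measurable fun y : Fin n → ℂ => y ⬝ᵥ D *ᵥ star y :=
        (continuous_id.dotProduct
          (continuous_const.matrix_mulVec continuous_star)).measurable
      have h3 : Measurable fun y : Fin n → ℂ => b ⬝ᵥ star y :=
        (continuous_const.dotProduct continuous_star).measurable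
      fun_prop
    obtain ⟨hI, hIv⟩ := integrable_prod_mul_ofReal (μ := volume) (ν := volume) (k := k) (g := g)
      hmeas.aestronglyMeasurable (fun _ _ => (Real.exp_pos _).le)
      (fun x hx => (integrable_gaussian_posDef hD b (hkx hx)).1) (by
        simp only [hkg]
        exact IntegrableOn.integrable_indicator
          ((integrable_cpow_mul_exp_neg hα0 hs).const_mul _) measurableSet_Ioi)
    have hmp := measurePreserving_borderedMatrix_add_schurShift n
    have hfac (q : (ℝ × (Fin n → ℂ)) × Matrix (Fin n) (Fin n) ℂ) :
        wishartKernel (borderedMatrix a b D) α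
          (borderedMatrix q.1.1 q.1.2 (q.2 + schurShift q.1.1 q.1.2)) =
        k q.1.1 * (g q.1.1 q.1.2 : ℂ) * wishartKernel D (α - 1) q.2 :=
      wishartKernel_borderedMatrix a q.1.1 b q.1.2 D q.2 α
    have hsm := (measurable_wishartKernel (borderedMatrix a b D) α).aestronglyMeasurable
      (μ := hermLebesgue (n + 1))
    rw [← hmp.map_eq] at hsm ⊢
    rw [integrable_map_measure hsm hmp.aemeasurable, integral_map hmp.aemeasurable hsm]
    simp only [Function.comp_def, hfac]
    refine ⟨hI.mul_prod hi, ?_⟩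
    rw [integral_prod_mul (fun q : ℝ × (Fin n → ℂ) => k q.1 * (g q.1 q.2 : ℂ)), hv,
      Measure.volume_eq_prod, hIv]
    simp only [hkg]
    rw [integral_indicator measurableSet_Ioi, integral_const_mul,
      Complex.integral_cpow_mul_exp_neg_mul_Ioi hα0 (by simpa using hs), cGammaP_succ, hdet,
      Complex.ofReal_mul, Complex.mul_cpow_ofReal_nonneg hs.le hd.le, one_div,
      Complex.inv_cpow _ _ (by rw [Complex.arg_ofReal_of_nonneg hs.le]; exact Real.pi_pos.ne),
      ← Complex.cpow_neg, neg_sub, sub_eq_add_neg 1 α,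
      Complex.cpow_add _ _ (by exact_mod_cast hd.ne'),
      Complex.cpow_one]
    have : (D.det.re : ℂ) ≠ 0 := by exact_mod_cast hd.ne'
    field_simp

lemma Matrix.PosDef.det_re_pos {p : ℕ} {A : Matrix (Fin p) (Fin p) ℂ} (hA : A.PosDef) :
    0 < A.det.re :=
  (Complex.lt_def.1 hA.det_pos).1

lemma cGammaP_ne_zero (p : ℕ) {α : ℂ} (hα : (p - 1 : ℝ) < α.re) : cGammaP p α ≠ 0 := by
  refine mul_ne_zero (pow_ne_zero _ (by exact_mod_cast Real.pi_ne_zero))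
    (Finset.prod_ne_zero_iff.2 fun j _ => Complex.Gamma_ne_zero_of_re_pos ?_)
  have hj : (j : ℝ) + 1 ≤ p := by exact_mod_cast j.2
  simp only [Complex.sub_re, Complex.natCast_re]
  linarith

lemma wishartKernel_mul_det_cpow {p : ℕ} (A X : Matrix (Fin p) (Fin p) ℂ) (α β : ℂ) :
    wishartKernel A α X * (X.det.re : ℂ) ^ β = wishartKernel A (α + β) X := by
  by_cases hX : X.PosDef
  · rw [wishartKernel, wishartKernel, Set.indicator_of_mem (show X ∈ {X | X.PosDef} from hX),
      Set.indicator_of_mem (show X ∈ {X | X.PosDef} from hX), mul_assoc,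
      ← Complex.cpow_add _ _ (by exact_mod_cast hX.det_re_pos.ne'), sub_add_eq_add_sub]
  · simp [wishartKernel, hX]

lemma ofReal_norm_wishartKernel {p : ℕ} (A X : Matrix (Fin p) (Fin p) ℂ) (α : ℂ) :
    (‖wishartKernel A α X‖ : ℂ) = wishartKernel A α.re X := by
  by_cases hX : X.PosDef
  · rw [wishartKernel, wishartKernel, Set.indicator_of_mem (show X ∈ {X | X.PosDef} from hX),
      Set.indicator_of_mem (show X ∈ {X | X.PosDef} from hX), norm_mul,
      Complex.norm_cpow_eq_rpow_re_of_pos hX.det_re_pos, Complex.norm_real,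
      Real.norm_of_nonneg (Real.exp_pos _).le, Complex.ofReal_mul,
      Complex.ofReal_cpow hX.det_re_pos.le]
    simp
  · simp [wishartKernel, hX]

lemma integral_norm_wishartKernel {p : ℕ} {A : Matrix (Fin p) (Fin p) ℂ} (hA : A.PosDef) {α : ℂ}
    (hα : (p - 1 : ℝ) < α.re) :
    ((∫ X, ‖wishartKernel A α X‖ ∂(hermLebesgue p) : ℝ) : ℂ) =
      cGammaP p α.re * (A.det.re : ℂ) ^ (-α.re : ℂ) := by
  rw [← integral_complex_ofReal]
  simp only [ofReal_norm_wishartKernel]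
  exact (integrable_wishartKernel p hA (by simpa using hα)).2

/-- The integrand of the matrix beta integral, extended by zero off the positive definite cone. -/
noncomputable def betaKernel {p : ℕ} (B : Matrix (Fin p) (Fin p) ℂ) (α γ : ℂ) :
    Matrix (Fin p) (Fin p) ℂ → ℂ :=
  {X | X.PosDef}.indicator fun X =>
    (X.det.re : ℂ) ^ (α - p) * ((B + X).det.re : ℂ) ^ (-γ)

lemma measurable_uncurry_betaKernel (p : ℕ) (α γ : ℂ) :
    Measurable fun q : Matrix (Fin p) (Fin p) ℂ × Matrix (Fin p) (Fin p) ℂ =>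
      betaKernel q.1 α γ q.2 := by
  have h1 : Continuous fun q : Matrix (Fin p) (Fin p) ℂ × Matrix (Fin p) (Fin p) ℂ =>
      (q.1 + q.2).det := (continuous_fst.add continuous_snd).matrix_det
  have h2 : Continuous fun q : Matrix (Fin p) (Fin p) ℂ × Matrix (Fin p) (Fin p) ℂ => q.2.det :=
    continuous_snd.matrix_det
  have := h1.measurable
  have := h2.measurable
  have h3 : (fun q : Matrix (Fin p) (Fin p) ℂ × Matrix (Fin p) (Fin p) ℂ =>
      betaKernel q.1 α γ q.2) = (Prod.snd ⁻¹' {X | X.PosDef}).indicator fun q =>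
        (q.2.det.re : ℂ) ^ (α - p) * ((q.1 + q.2).det.re : ℂ) ^ (-γ) := by
    ext q
    simp [betaKernel, Set.indicator]
  rw [h3]
  exact Measurable.indicator (by fun_prop) (measurable_snd (measurableSet_posDef p))

lemma ofReal_norm_betaKernel {p : ℕ} {B : Matrix (Fin p) (Fin p) ℂ} (hB : B.PosDef)
    (X : Matrix (Fin p) (Fin p) ℂ) (α γ : ℂ) :
    (‖betaKernel B α γ X‖ : ℂ) = betaKernel B α.re γ.re X := by
  by_cases hX : X.PosDef
  · have hBX := (hB.add hX).det_re_pos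
    rw [betaKernel, betaKernel, Set.indicator_of_mem (show X ∈ {X | X.PosDef} from hX),
      Set.indicator_of_mem (show X ∈ {X | X.PosDef} from hX), norm_mul,
      Complex.norm_cpow_eq_rpow_re_of_pos hX.det_re_pos,
      Complex.norm_cpow_eq_rpow_re_of_pos hBX, Complex.ofReal_mul,
      Complex.ofReal_cpow hX.det_re_pos.le, Complex.ofReal_cpow hBX.le]
    simp
  · simp [betaKernel, hX]

lemma wishartKernel_mul_wishartKernel {p : ℕ} (B X Z : Matrix (Fin p) (Fin p) ℂ) (α γ : ℂ) :
    wishartKernel B γ Z * wishartKernel Z α X =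
      {X : Matrix (Fin p) (Fin p) ℂ | X.PosDef}.indicator
        (fun X => (X.det.re : ℂ) ^ (α - p) * wishartKernel (B + X) γ Z) X := by
  by_cases hX : X.PosDef
  swap
  · simp [wishartKernel, hX]
  by_cases hZ : Z.PosDef
  swap
  · simp [wishartKernel, hZ]
  simp only [wishartKernel, Set.indicator, Set.mem_ofPred_eq, hX, hZ, if_true, Matrix.add_mul,
    trace_add, Complex.add_re, neg_add, Real.exp_add, trace_mul_comm Z X]
  push_cast
  ring

lemma integrable_betaKernel {p : ℕ} {B : Matrix (Fin p) (Fin p) ℂ} (hB : B.PosDef) {α γ : ℂ}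
    (hα : (p - 1 : ℝ) < α.re) (hγ : (p - 1 : ℝ) < (γ - α).re) (hc : (p - 1 : ℝ) < γ.re) :
    Integrable (betaKernel B α γ) (hermLebesgue p) ∧
      ∫ X, betaKernel B α γ X ∂(hermLebesgue p) =
        cGammaP p α * cGammaP p (γ - α) / cGammaP p γ * (B.det.re : ℂ) ^ (-(γ - α)) := by
  have hΓ := cGammaP_ne_zero p hc
  have hpos {Z : Matrix (Fin p) (Fin p) ℂ} (hZ : wishartKernel B γ Z ≠ 0) : Z.PosDef :=
    Set.mem_of_indicator_ne_zero (s := {X : Matrix (Fin p) (Fin p) ℂ | X.PosDef}) hZ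
  obtain ⟨hF, hFi⟩ := integrable_prod_mul (μ := hermLebesgue p) (ν := hermLebesgue p)
    (k := wishartKernel B γ) (g := fun Z => wishartKernel Z α)
    (((measurable_wishartKernel B γ).comp measurable_fst).mul
      (measurable_uncurry_wishartKernel p α)).aestronglyMeasurable
    (fun Z hZ => (integrable_wishartKernel p (hpos hZ) hα).1) (by
      refine ((integrable_wishartKernel p hB (α := (γ.re + -α.re : ℂ))
        (by simpa [sub_eq_add_neg] using hγ)).1.const_mul (cGammaP p α.re)).congr
          (.of_forall fun Z => ?_)
      simp only [ofReal_norm_wishartKernel, ← wishartKernel_mul_det_cpow]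
      by_cases hZ : Z.PosDef
      · rw [← ofReal_norm_wishartKernel, integral_norm_wishartKernel hZ hα]
        ring
      · simp [wishartKernel, hZ])
  have hinner (Z : Matrix (Fin p) (Fin p) ℂ) :
      wishartKernel B γ Z * ∫ X, wishartKernel Z α X ∂(hermLebesgue p) =
        cGammaP p α * wishartKernel B (γ - α) Z := by
    rw [sub_eq_add_neg, ← wishartKernel_mul_det_cpow]
    by_cases hZ : Z.PosDef
    · rw [(integrable_wishartKernel p hZ hα).2]
      ring
    · simp [wishartKernel, hZ]
  have houter (X : Matrix (Fin p) (Fin p) ℂ) :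
      ∫ Z, wishartKernel B γ Z * wishartKernel Z α X ∂(hermLebesgue p) =
        cGammaP p γ * betaKernel B α γ X := by
    simp only [wishartKernel_mul_wishartKernel]
    by_cases hX : X.PosDef
    · simp only [betaKernel, Set.indicator_of_mem (show X ∈ {X | X.PosDef} from hX),
        integral_const_mul, (integrable_wishartKernel p (hB.add hX) hc).2]
      ring
    · simp [betaKernel, hX]
  have hright := hF.integral_prod_right
  simp only [houter] at hright
  refine ⟨(integrable_const_mul_iff hΓ.isUnit _).1 hright, ?_⟩
  rw [integral_prod_symm _ hF] at hFi
  simp only [houter, hinner, integral_const_mul, (integrable_wishartKernel p hB hγ).2] at hFi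
  field_simp
  linear_combination hFi

lemma integral_norm_betaKernel {p : ℕ} {B : Matrix (Fin p) (Fin p) ℂ} (hB : B.PosDef) {α γ : ℂ}
    (hα : (p - 1 : ℝ) < α.re) (hγ : (p - 1 : ℝ) < (γ - α).re) (hc : (p - 1 : ℝ) < γ.re) :
    ((∫ X, ‖betaKernel B α γ X‖ ∂(hermLebesgue p) : ℝ) : ℂ) =
      cGammaP p α.re * cGammaP p (γ.re - α.re) / cGammaP p γ.re *
        (B.det.re : ℂ) ^ (-(γ.re - α.re : ℂ)) := by
  rw [← integral_complex_ofReal]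
  simp only [ofReal_norm_betaKernel hB]
  exact (integrable_betaKernel hB (by simpa using hα) (by simpa using hγ) (by simpa using hc)).2

theorem stmt16 (p : ℕ) (hp : 1 ≤ p) (A : Matrix (Fin p) (Fin p) ℂ) (hA : A.PosDef)
    (α₁ α₂ α₃ : ℂ) (hα₁ : (p - 1 : ℝ) < α₁.re) (hα₂ : (p - 1 : ℝ) < α₂.re)
    (hα₃ : (p - 1 : ℝ) < α₃.re) :
    ∫ X in {X : Matrix (Fin p) (Fin p) ℂ × Matrix (Fin p) (Fin p) ℂ |
        X.1.PosDef ∧ X.2.PosDef},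
      ((Real.exp (-(A * X.1).trace.re) * (((1 + X.1).det.re : ℂ) ^ (α₁ + α₃))) *
        ((cGammaP p (α₁ + α₂ + α₃) / (cGammaP p α₁ * cGammaP p α₂ * cGammaP p α₃)) *
          ((X.1.det.re : ℂ) ^ (α₁ - p)) * ((X.2.det.re : ℂ) ^ (α₂ - p)) *
          (((1 + X.1 + X.2).det.re : ℂ) ^ (-(α₁ + α₂ + α₃)))))
      ∂((hermLebesgue p).prod (hermLebesgue p))
    = cGammaP p (α₁ + α₃) / cGammaP p α₃ * (A.det.re : ℂ) ^ (-α₁) := by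
  have hp' : (1 : ℝ) ≤ p := by exact_mod_cast hp
  have h13 : (p - 1 : ℝ) < (α₁ + α₃).re := by rw [Complex.add_re]; linarith
  have h123 : (p - 1 : ℝ) < (α₁ + α₂ + α₃).re := by simp only [Complex.add_re]; linarith
  have hsub : α₁ + α₂ + α₃ - α₂ = α₁ + α₃ := by ring
  have h13' : (p - 1 : ℝ) < (α₁ + α₂ + α₃ - α₂).re := by rwa [hsub]
  have hone {X : Matrix (Fin p) (Fin p) ℂ} (hX : X.PosDef) : (1 + X).PosDef := PosDef.one.add hX
  have hcpow {X : Matrix (Fin p) (Fin p) ℂ} (hX : X.PosDef) (z : ℂ) :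
      ((1 + X).det.re : ℂ) ^ z ≠ 0 :=
    Complex.cpow_ne_zero_iff.2 (Or.inl (by exact_mod_cast (hone hX).det_re_pos.ne'))
  set C := cGammaP p (α₁ + α₂ + α₃) / (cGammaP p α₁ * cGammaP p α₂ * cGammaP p α₃) with hC
  set k : Matrix (Fin p) (Fin p) ℂ → ℂ := fun X =>
    wishartKernel A α₁ X * ((1 + X).det.re : ℂ) ^ (α₁ + α₃) with hk
  have hpos {X : Matrix (Fin p) (Fin p) ℂ} (hX : k X ≠ 0) : X.PosDef :=
    Set.mem_of_indicator_ne_zero (s := {X : Matrix (Fin p) (Fin p) ℂ | X.PosDef})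
      (left_ne_zero_of_mul hX)
  have hadd : Continuous fun X : Matrix (Fin p) (Fin p) ℂ => 1 + X :=
    continuous_const.add continuous_id
  have hkm : Measurable k := by
    have := hadd.matrix_det.measurable
    have := measurable_wishartKernel A α₁
    fun_prop
  have hgm : Measurable fun q : Matrix (Fin p) (Fin p) ℂ × Matrix (Fin p) (Fin p) ℂ =>
      betaKernel (1 + q.1) α₂ (α₁ + α₂ + α₃) q.2 := by
    have h := (measurable_uncurry_betaKernel p α₂ (α₁ + α₂ + α₃)).comp
      ((hadd.measurable.comp measurable_fst).prodMk measurable_snd)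
    exact h
  have hn : Integrable (fun X => (‖wishartKernel A α₁ X‖ : ℂ)) (hermLebesgue p) :=
    (integrable_wishartKernel p hA hα₁).1.norm.ofReal
  obtain ⟨-, hI⟩ := integrable_prod_mul (μ := hermLebesgue p) (ν := hermLebesgue p)
    (k := k) (g := fun X => betaKernel (1 + X) α₂ (α₁ + α₂ + α₃))
    ((hkm.comp measurable_fst).mul hgm).aestronglyMeasurable
    (fun X hX => (integrable_betaKernel (hone (hpos hX)) hα₂ h13' h123).1) (by
      refine (hn.const_mul
        (cGammaP p α₂.re * cGammaP p ((α₁ + α₂ + α₃).re - α₂.re) /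
          cGammaP p (α₁ + α₂ + α₃).re)).congr (.of_forall fun X => ?_)
      by_cases hX : X.PosDef
      · have hd := (hone hX).det_re_pos
        have he : (α₁ + α₃).re = (α₁ + α₂ + α₃).re - α₂.re := by simp; ring
        simp only [hk]
        rw [integral_norm_betaKernel (hone hX) hα₂ h13' h123, norm_mul,
          Complex.norm_cpow_eq_rpow_re_of_pos hd, Complex.ofReal_mul, Complex.ofReal_cpow hd.le,
          he, Complex.ofReal_sub, Complex.cpow_neg]
        have := hcpow hX ((α₁ + α₂ + α₃).re - α₂.re)
        field_simp
      · simp [hk, wishartKernel, hX])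
  have hinner (X : Matrix (Fin p) (Fin p) ℂ) :
      k X * ∫ Y, betaKernel (1 + X) α₂ (α₁ + α₂ + α₃) Y ∂(hermLebesgue p) =
        cGammaP p α₂ * cGammaP p (α₁ + α₃) / cGammaP p (α₁ + α₂ + α₃) * wishartKernel A α₁ X := by
    by_cases hX : X.PosDef
    · have hd' : ((1 + X).det.re : ℂ) ≠ 0 := by exact_mod_cast (hone hX).det_re_pos.ne'
      rw [(integrable_betaKernel (hone hX) hα₂ h13' h123).2, hsub, Complex.cpow_neg]
      have := hcpow hX (α₁ + α₃)
      simp only [hk]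
      field_simp
    · simp [hk, wishartKernel, hX]
  have hset : MeasurableSet {X : Matrix (Fin p) (Fin p) ℂ × Matrix (Fin p) (Fin p) ℂ |
      X.1.PosDef ∧ X.2.PosDef} := (measurableSet_posDef p).prod (measurableSet_posDef p)
  calc
    _ = ∫ X, C * (k X.1 * betaKernel (1 + X.1) α₂ (α₁ + α₂ + α₃) X.2)
        ∂((hermLebesgue p).prod (hermLebesgue p)) := by
      rw [← integral_indicator hset]
      congr 1 with X
      by_cases h1 : X.1.PosDef
      swap
      · simp [hk, wishartKernel, h1]
      by_cases h2 : X.2.PosDef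
      swap
      · simp [betaKernel, h2]
      simp only [hk, wishartKernel, betaKernel, Set.indicator, Set.mem_ofPred_eq, h1, h2, and_self,
        if_true]
      ring
    _ = _ := by
      have n1 := cGammaP_ne_zero p hα₁
      have n2 := cGammaP_ne_zero p hα₂
      have n123 := cGammaP_ne_zero p h123
      rw [integral_const_mul, hI]
      simp only [hinner]
      rw [integral_const_mul, (integrable_wishartKernel p hA hα₁).2, hC]
      field_simp
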